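/- arXiv:1206.5031 — 3 statements merged into one kernel-verified Lean document; each statement's English description precedes it below -/
import Mathlib

section
/- For q > 1, the improper integral ∫_0^∞ sin(η^q) dη converges and equals Γ(1 + 1/q) · sin(π/(2q)). -/
open Real Filter

/-- The integrand of `∫ exp (-z ^ q) dz` along the ray `z = r * exp (θ * I)`. -/
noncomputable def rayIntegrand (q θ r : ℝ) : ℂ :=
  Complex.exp (θ * Complex.I - (r ^ q : ℝ) * Complex.exp ((q * θ : ℝ) * Complex.I))

/-- The derivative of `rayIntegrand q θ r` with respect to `θ`. -/
noncomputable def rayIntegrandDeriv (q θ r : ℝ) : ℂ :=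
  (Complex.I - (r ^ q : ℝ) * (Complex.exp ((q * θ : ℝ) * Complex.I) * (q * Complex.I))) *
    rayIntegrand q θ r

lemma norm_rayIntegrand (q θ r : ℝ) :
    ‖rayIntegrand q θ r‖ = Real.exp (-(r ^ q * Real.cos (q * θ))) := by
  rw [rayIntegrand, Complex.norm_exp]
  congr 1
  simp [-Complex.ofReal_mul, Complex.exp_ofReal_mul_I_re]

lemma continuous_rayIntegrand {q : ℝ} (hq : 0 ≤ q) (θ : ℝ) :
    Continuous (rayIntegrand q θ) := by
  have h : Continuous fun r : ℝ => r ^ q := Real.continuous_rpow_const hq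
  unfold rayIntegrand
  fun_prop

lemma continuous_rayIntegrandDeriv {q : ℝ} (hq : 0 ≤ q) (θ : ℝ) :
    Continuous (rayIntegrandDeriv q θ) := by
  have h : Continuous fun r : ℝ => r ^ q := Real.continuous_rpow_const hq
  have h' := continuous_rayIntegrand hq θ
  unfold rayIntegrandDeriv
  fun_prop

lemma hasDerivAt_rayIntegrand_angle (q θ r : ℝ) :
    HasDerivAt (fun t => rayIntegrand q t r) (rayIntegrandDeriv q θ r) θ := by
  have h₁ : HasDerivAt (fun t : ℝ => (t : ℂ) * Complex.I) Complex.I θ := by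
    simpa using (Complex.ofRealCLM.hasDerivAt (x := θ)).mul_const Complex.I
  have h₂ : HasDerivAt (fun t : ℝ => ((q * t : ℝ) : ℂ) * Complex.I) (q * Complex.I) θ := by
    simpa [mul_assoc] using h₁.const_mul (q : ℂ)
  have h := (h₁.sub (h₂.cexp.const_mul ((r ^ q : ℝ) : ℂ))).cexp
  rw [mul_comm] at h
  exact h

/-- The angular derivative of `rayIntegrand` is exact as a function of the radius. -/
lemma hasDerivAt_mul_rayIntegrand_radius {q : ℝ} (hq : 1 ≤ q) (θ : ℝ) {r : ℝ} (hr : 0 ≤ r) :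
    HasDerivAt (fun x : ℝ => Complex.I * x * rayIntegrand q θ x) (rayIntegrandDeriv q θ r) r := by
  have h₁ := (Real.hasDerivAt_rpow_const (x := r) (Or.inr hq)).ofReal_comp
  have h₂ := ((h₁.mul_const (Complex.exp ((q * θ : ℝ) * Complex.I))).const_sub
    (θ * Complex.I)).cexp
  have h₃ : HasDerivAt (fun x : ℝ => Complex.I * (x : ℂ)) Complex.I r := by
    simpa using (Complex.ofRealCLM.hasDerivAt (x := r)).const_mul Complex.I
  have hpow : r * r ^ (q - 1) = r ^ q := by
    rw [mul_comm, ← Real.rpow_add_one' hr (by linarith), sub_add_cancel]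
  refine (h₃.mul h₂).congr_deriv ?_
  rw [rayIntegrandDeriv, ← hpow, rayIntegrand]
  push_cast
  rw [show r ^ q = r * r ^ (q - 1) from hpow.symm]
  push_cast
  ring

lemma norm_rayIntegrandDeriv_le {q r R : ℝ} (hq : 0 ≤ q) (hr : 0 ≤ r) (hrR : r ≤ R) (θ : ℝ) :
    ‖rayIntegrandDeriv q θ r‖ ≤ (1 + R ^ q * q) * Real.exp (R ^ q) := by
  have hpow : r ^ q ≤ R ^ q := Real.rpow_le_rpow hr hrR hq
  have hpow₀ : 0 ≤ r ^ q := Real.rpow_nonneg hr q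
  have hR : 0 ≤ R := hr.trans hrR
  rw [rayIntegrandDeriv, norm_mul, norm_rayIntegrand]
  gcongr
  · refine (norm_sub_le _ _).trans ?_
    rw [norm_mul, norm_mul, norm_mul, Complex.norm_exp_ofReal_mul_I, Complex.norm_I,
      Complex.norm_real, Complex.norm_real, Real.norm_of_nonneg hpow₀, Real.norm_of_nonneg hq]
    nlinarith
  · nlinarith [Real.neg_one_le_cos (q * θ)]

lemma hasDerivAt_integral_rayIntegrand {q R : ℝ} (hq : 1 ≤ q) (hR : 0 ≤ R) (θ : ℝ) :
    HasDerivAt (fun t => ∫ r in (0 : ℝ)..R, rayIntegrand q t r)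
      (Complex.I * R * rayIntegrand q θ R) θ := by
  have hq₀ : 0 ≤ q := by linarith
  have h := (intervalIntegral.hasDerivAt_integral_of_dominated_loc_of_deriv_le
    (μ := MeasureTheory.volume) (a := 0) (b := R) (F := rayIntegrand q)
    (F' := rayIntegrandDeriv q) (x₀ := θ)
    (bound := fun _ => (1 + R ^ q * q) * Real.exp (R ^ q)) Filter.univ_mem
    (Eventually.of_forall fun t => (continuous_rayIntegrand hq₀ t).aestronglyMeasurable)
    ((continuous_rayIntegrand hq₀ θ).intervalIntegrable _ _)
    (continuous_rayIntegrandDeriv hq₀ θ).aestronglyMeasurable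
    (Eventually.of_forall fun r hr t _ => by
      rw [Set.uIoc_of_le hR] at hr
      exact norm_rayIntegrandDeriv_le hq₀ hr.1.le hr.2 t)
    intervalIntegrable_const
    (Eventually.of_forall fun r _ t _ => hasDerivAt_rayIntegrand_angle q t r)).2
  rw [intervalIntegral.integral_eq_sub_of_hasDerivAt
    (f := fun x : ℝ => Complex.I * x * rayIntegrand q θ x)
    (fun r hr => hasDerivAt_mul_rayIntegrand_radius hq θ (by
      rw [Set.uIcc_of_le hR] at hr
      exact hr.1))
    ((continuous_rayIntegrandDeriv hq₀ θ).intervalIntegrable _ _)] at h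
  simpa using h

/-- The integrals along the rays of angle `0` and `π / (2 * q)` differ by the contribution of a
circular arc, which is bounded through Jordan's inequality. -/
lemma norm_integral_rayIntegrand_sub_le {q R : ℝ} (hq : 1 ≤ q) (hR : 0 < R) :
    ‖(∫ r in (0 : ℝ)..R, rayIntegrand q (π / (2 * q)) r) - ∫ r in (0 : ℝ)..R, rayIntegrand q 0 r‖
      ≤ π / (2 * q) * R ^ (1 - q) := by
  have hq₀ : 0 < q := by linarith
  have hpow : 0 < R ^ q := Real.rpow_pos_of_pos hR q
  have hpi := Real.pi_pos
  set G : ℝ → ℂ := fun t => ∫ r in (0 : ℝ)..R, rayIntegrand q t r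
  have hG : ∀ t, HasDerivAt (fun t => G t - G 0) (Complex.I * R * rayIntegrand q t R) t :=
    fun t => (hasDerivAt_integral_rayIntegrand hq hR.le t).sub_const _
  set c : ℝ := R ^ q * (2 / π * q)
  have hc : 0 < c := by positivity
  have hB : ∀ t : ℝ, HasDerivAt (fun t => R / c * Real.exp (c * t - R ^ q))
      (R * Real.exp (c * t - R ^ q)) t := fun t => by
    have h := ((((hasDerivAt_id t).const_mul c).sub_const (R ^ q)).exp).const_mul (R / c)
    refine h.congr_deriv ?_
    simp only [id]
    field_simp
  have h := image_norm_le_of_norm_deriv_right_le_deriv_boundary (f := fun t => G t - G 0)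
    (a := 0) (b := π / (2 * q))
    (fun t _ => (hG t).continuousAt.continuousWithinAt)
    (fun t _ => (hG t).hasDerivWithinAt)
    (B := fun t => R / c * Real.exp (c * t - R ^ q))
    (by simp only [sub_self, norm_zero]; positivity) hB
    (fun t ht => by
      rw [norm_mul, norm_mul, Complex.norm_I, one_mul, Complex.norm_real,
        Real.norm_of_nonneg hR.le, norm_rayIntegrand]
      have ht₂ : q * t ≤ π / 2 := by
        have := (lt_div_iff₀ (by positivity)).1 ht.2
        linarith
      have hcos := mul_le_mul_of_nonneg_left
        (Real.one_sub_mul_le_cos (mul_nonneg hq₀.le ht.1) ht₂) hpow.le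
      gcongr
      simp only [c]
      linarith)
    (Set.right_mem_Icc.2 (by positivity))
  refine h.trans_eq ?_
  have hexp : c * (π / (2 * q)) - R ^ q = 0 := by
    simp only [c]
    field_simp
    ring
  simp only [hexp, Real.exp_zero, mul_one, c]
  rw [Real.rpow_sub hR, Real.rpow_one]
  field_simp

lemma tendsto_integral_rayIntegrand_zero {q : ℝ} (hq : 0 < q) :
    Tendsto (fun R : ℝ => ∫ r in (0 : ℝ)..R, rayIntegrand q 0 r) atTop
      (nhds (Real.Gamma (1 + 1 / q) : ℂ)) := by
  have hint : MeasureTheory.IntegrableOn (fun x : ℝ => Real.exp (-x ^ q)) (Set.Ioi 0) := by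
    simpa using integrableOn_rpow_mul_exp_neg_rpow (s := 0) (by norm_num) hq
  have h := MeasureTheory.intervalIntegral_tendsto_integral_Ioi 0 hint tendsto_id
  rw [integral_exp_neg_rpow hq, add_comm] at h
  refine ((Complex.continuous_ofReal.tendsto _).comp h).congr fun R => ?_
  simp only [Function.comp_apply, id]
  rw [← intervalIntegral.integral_ofReal]
  simp [rayIntegrand]

lemma rayIntegrand_pi_div {q : ℝ} (hq : q ≠ 0) (r : ℝ) :
    rayIntegrand q (π / (2 * q)) r =
      Complex.exp ((π / (2 * q) : ℝ) * Complex.I) * Complex.exp ((-r ^ q : ℝ) * Complex.I) := by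
  have h : q * (π / (2 * q)) = π / 2 := by field_simp
  rw [rayIntegrand, ← Complex.exp_add, h, Complex.ofReal_div π 2, Complex.ofReal_ofNat,
    Complex.exp_pi_div_two_mul_I]
  push_cast
  ring_nf

/-- Generalized Fresnel integral: for `q > 1`,
`lim_{R→∞} ∫_0^R sin(η^q) dη = Γ(1+1/q)·sin(π/(2q))`. -/
theorem stmt_7 (q : ℝ) (hq : 1 < q) :
    Tendsto (fun R : ℝ => ∫ η in (0 : ℝ)..R, Real.sin (η ^ q)) atTop
      (nhds (Real.Gamma (1 + 1 / q) * Real.sin (π / (2 * q)))) := by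
  have hq₀ : 0 < q := by linarith
  set α : ℝ := π / (2 * q)
  have harc : Tendsto (fun R : ℝ => (∫ r in (0 : ℝ)..R, rayIntegrand q α r) -
      ∫ r in (0 : ℝ)..R, rayIntegrand q 0 r) atTop (nhds 0) := by
    refine squeeze_zero_norm' ((eventually_gt_atTop 0).mono fun R hR =>
      norm_integral_rayIntegrand_sub_le hq.le hR) ?_
    have h := (tendsto_rpow_neg_atTop (sub_pos.2 hq)).const_mul (π / (2 * q))
    simpa using h
  have hray := harc.add (tendsto_integral_rayIntegrand_zero hq₀)
  simp only [sub_add_cancel, zero_add] at hray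
  have him := (Complex.continuous_im.tendsto _).comp
    (hray.const_mul (-Complex.exp ((-α : ℝ) * Complex.I)))
  have hlim : (-Complex.exp ((-α : ℝ) * Complex.I) * (Real.Gamma (1 + 1 / q) : ℂ)).im =
      Real.Gamma (1 + 1 / q) * Real.sin α := by
    rw [Complex.im_mul_ofReal, Complex.neg_im, Complex.exp_ofReal_mul_I_im, Real.sin_neg]
    ring
  rw [hlim] at him
  refine him.congr fun R => ?_
  have hcont : Continuous fun r : ℝ => r ^ q := Real.continuous_rpow_const hq₀.le
  have hrot : ∀ r : ℝ, -Complex.exp ((-α : ℝ) * Complex.I) * rayIntegrand q α r =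
      -Complex.exp ((-r ^ q : ℝ) * Complex.I) := fun r => by
    rw [rayIntegrand_pi_div hq₀.ne', ← mul_assoc, neg_mul, ← Complex.exp_add]
    simp [α]
  simp only [Function.comp_apply]
  rw [← intervalIntegral.integral_const_mul]
  simp only [hrot]
  rw [← Complex.imCLM_apply, ← Complex.imCLM.intervalIntegral_comp_comm
    (Continuous.intervalIntegrable (by fun_prop) _ _)]
  refine intervalIntegral.integral_congr fun r _ => ?_
  simp only [Complex.imCLM_apply]
  rw [Complex.neg_im, Complex.exp_ofReal_mul_I_im, Real.sin_neg, neg_neg]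
end

section
/- For p > 1 there exists a constant C > 0 such that for all t ∈ ℝ, |∑_{n=1}^∞ sin(t/n^p) − α_p · sign(t) · |t|^{1/p}| ≤ C · |t|^{1/(p+1)}, where α_p = Γ(1 − 1/p) · sin(π/(2p)). -/
open Real

open MeasureTheory Set Filter Topology

theorem integrableOn_rpow_mul_exp_neg_mul {q r : ℝ} (hq : -1 < q) (hr : 0 < r) :
    IntegrableOn (fun x : ℝ => x ^ q * exp (-(r * x))) (Ioi 0) := by
  refine (integrableOn_rpow_mul_exp_neg_mul_rpow hq one_pos hr).congr_fun (fun x _ => ?_)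
    measurableSet_Ioi
  simp

theorem norm_rpow_mul_cexp_neg_mul {q x : ℝ} (hx : 0 < x) (z : ℂ) :
    ‖((x ^ q : ℝ) : ℂ) * Complex.exp (-(z * x))‖ = x ^ q * exp (-(z.re * x)) := by
  rw [norm_mul, Complex.norm_exp, Complex.norm_real, Real.norm_of_nonneg (by positivity)]
  simp

theorem measurable_rpow_mul_cexp_neg_mul (q : ℝ) (z : ℂ) :
    Measurable (fun x : ℝ => ((x ^ q : ℝ) : ℂ) * Complex.exp (-(z * x))) := by
  fun_prop

theorem integrableOn_rpow_mul_cexp_neg_mul {q : ℝ} (hq : -1 < q) {z : ℂ} (hz : 0 < z.re) :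
    IntegrableOn (fun x : ℝ => ((x ^ q : ℝ) : ℂ) * Complex.exp (-(z * x))) (Ioi 0) := by
  refine (integrableOn_rpow_mul_exp_neg_mul hq hz).mono'
    (measurable_rpow_mul_cexp_neg_mul q z).aestronglyMeasurable ?_
  filter_upwards [ae_restrict_mem measurableSet_Ioi] with x hx
  exact (norm_rpow_mul_cexp_neg_mul hx z).le

theorem differentiableAt_integral_rpow_mul_cexp_neg_mul {q : ℝ} (hq : -1 < q) {z : ℂ}
    (hz : 0 < z.re) :
    DifferentiableAt ℂ
      (fun w : ℂ => ∫ x in Ioi (0 : ℝ), ((x ^ q : ℝ) : ℂ) * Complex.exp (-(w * x))) z := by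
  have hs : {w : ℂ | z.re / 2 < w.re} ∈ 𝓝 z :=
    (isOpen_lt continuous_const Complex.continuous_re).mem_nhds (half_lt_self hz)
  refine (hasDerivAt_integral_of_dominated_loc_of_deriv_le
    (F' := fun w x => -(x : ℂ) * (((x ^ q : ℝ) : ℂ) * Complex.exp (-(w * x))))
    (bound := fun x => x ^ (q + 1) * exp (-(z.re / 2 * x))) hs
    (.of_forall fun w => (measurable_rpow_mul_cexp_neg_mul q w).aestronglyMeasurable)
    (integrableOn_rpow_mul_cexp_neg_mul hq hz) ?_ ?_
    (integrableOn_rpow_mul_exp_neg_mul (by linarith) (half_pos hz)) ?_).2.differentiableAt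
  · exact Measurable.aestronglyMeasurable (by fun_prop)
  · filter_upwards [ae_restrict_mem measurableSet_Ioi] with x (hx : 0 < x) w (hw : _ < _)
    rw [norm_mul, norm_rpow_mul_cexp_neg_mul hx, norm_neg, Complex.norm_real,
      Real.norm_of_nonneg hx.le, rpow_add_one hx.ne', ← mul_assoc, mul_comm x]
    gcongr
  · refine .of_forall fun x w _ => ?_
    have h : HasDerivAt (fun w : ℂ => -(w * x)) (-(x : ℂ)) w :=
      ((hasDerivAt_id w).mul_const (x : ℂ)).neg.congr_deriv (by simp)
    exact (h.cexp.const_mul _).congr_deriv (by ring)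

/-- The Laplace transform of a power, on the right half-plane. -/
theorem integral_rpow_mul_cexp_neg_mul {s : ℝ} (hs : 0 < s) {z : ℂ} (hz : 0 < z.re) :
    ∫ x in Ioi (0 : ℝ), ((x ^ (s - 1) : ℝ) : ℂ) * Complex.exp (-(z * x))
      = z ^ (-s : ℂ) * (Real.Gamma s : ℂ) := by
  have hU : IsOpen {w : ℂ | 0 < w.re} := isOpen_lt continuous_const Complex.continuous_re
  have hf : AnalyticOnNhd ℂ (fun w : ℂ => ∫ x in Ioi (0 : ℝ),
      ((x ^ (s - 1) : ℝ) : ℂ) * Complex.exp (-(w * x))) {w : ℂ | 0 < w.re} :=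
    DifferentiableOn.analyticOnNhd (fun w hw =>
      (differentiableAt_integral_rpow_mul_cexp_neg_mul (by linarith) hw).differentiableWithinAt) hU
  have hg : AnalyticOnNhd ℂ (fun w : ℂ => w ^ (-s : ℂ) * (Real.Gamma s : ℂ))
      {w : ℂ | 0 < w.re} := by
    refine DifferentiableOn.analyticOnNhd (fun w hw => ?_) hU
    exact ((differentiableAt_id.cpow_const (Or.inl hw)).mul_const _).differentiableWithinAt
  refine hf.eqOn_of_preconnected_of_frequently_eq hg
    (convex_halfSpace_re_gt 0).isPreconnected (z₀ := 1) (by simp) ?_ hz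
  have hlim : Tendsto (fun r : ℝ => (r : ℂ)) (𝓝[>] 1) (𝓝[≠] 1) := by
    refine tendsto_nhdsWithin_iff.2 ⟨?_, ?_⟩
    · exact (Complex.continuous_ofReal.tendsto' 1 1 (by simp)).mono_left nhdsWithin_le_nhds
    · filter_upwards [self_mem_nhdsWithin] with r (hr : 1 < r)
      simpa using hr.ne'
  refine hlim.frequently (Eventually.frequently ?_)
  filter_upwards [self_mem_nhdsWithin] with r (hr : 1 < r)
  have hr0 : 0 < r := by linarith
  have h := Real.integral_rpow_mul_exp_neg_mul_Ioi hs hr0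
  rw [← Complex.ofReal_inj, ← integral_complex_ofReal] at h
  push_cast at h ⊢
  rw [h, one_div, inv_rpow hr0.le, ← rpow_neg hr0.le,
    Complex.ofReal_cpow hr0.le]
  push_cast
  rfl

theorem integrableOn_rpow_mul_sin {a t : ℝ} (ha0 : 0 < a) (ha1 : a < 1) :
    IntegrableOn (fun x : ℝ => x ^ (-a - 1) * sin (t * x)) (Ioi 0) := by
  have hm (s : Set ℝ) : AEStronglyMeasurable (fun x : ℝ => x ^ (-a - 1) * sin (t * x))
      (volume.restrict s) := Measurable.aestronglyMeasurable (by fun_prop)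
  rw [← Ioc_union_Ioi_eq_Ioi zero_le_one]
  refine IntegrableOn.union ?_ ?_
  · have h : IntegrableOn (fun x : ℝ => |t| * x ^ (-a)) (Ioc 0 1) :=
      ((intervalIntegrable_iff_integrableOn_Ioc_of_le zero_le_one).1
        (intervalIntegral.intervalIntegrable_rpow' (r := -a) (by linarith))).const_mul _
    refine h.mono' (hm _) ?_
    filter_upwards [ae_restrict_mem measurableSet_Ioc] with x hx
    have hx0 : 0 < x := hx.1
    rw [norm_mul, Real.norm_of_nonneg (by positivity), Real.norm_eq_abs]
    calc x ^ (-a - 1) * |sin (t * x)| ≤ x ^ (-a - 1) * (|t| * x) := by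
          gcongr
          exact abs_sin_le_abs.trans (by rw [abs_mul, abs_of_pos hx0])
      _ = |t| * x ^ (-a) := by
          rw [rpow_sub_one hx0.ne']
          field_simp
  · refine (integrableOn_Ioi_rpow_of_lt (a := -a - 1) (by linarith) one_pos).mono' (hm _) ?_
    filter_upwards [ae_restrict_mem measurableSet_Ioi] with x hx
    have hx0 : 0 < x := one_pos.trans hx
    rw [norm_mul, Real.norm_of_nonneg (by positivity), Real.norm_eq_abs]
    exact mul_le_of_le_one_right (by positivity) (abs_sin_le_one _)

theorem norm_rpow_mul_sin_mul_exp_le {a t ε x : ℝ} (hε : 0 ≤ ε) (hx : 0 < x) :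
    ‖x ^ (-a - 1) * (sin (t * x) * exp (-(ε * x)))‖ ≤ ‖x ^ (-a - 1) * sin (t * x)‖ := by
  rw [← mul_assoc, norm_mul _ (exp _)]
  refine mul_le_of_le_one_right (norm_nonneg _) ?_
  rw [Real.norm_of_nonneg (exp_pos _).le, exp_le_one_iff]
  nlinarith

theorem im_cexp_neg_mul (ε t x : ℝ) :
    (Complex.exp (-((ε - t * Complex.I) * x))).im = sin (t * x) * exp (-(ε * x)) := by
  simp [Complex.exp_im, mul_comm]

theorem integral_rpow_mul_sin_mul_exp {a t ε : ℝ} (ha0 : 0 < a) (ha1 : a < 1) (hε : 0 < ε) :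
    a * ∫ x in Ioi (0 : ℝ), x ^ (-a - 1) * (sin (t * x) * exp (-(ε * x)))
      = -(Real.Gamma (1 - a) * ((ε - t * Complex.I : ℂ) ^ (a : ℂ)).im) := by
  set z : ℂ := ε - t * Complex.I with hz
  have hzre : z.re = ε := by simp [hz]
  have hz0 : z ≠ 0 := fun h => hε.ne' (by rw [← hzre, h, Complex.zero_re])
  have hint : IntegrableOn
      (fun x : ℝ => -z * (((x ^ (-a) : ℝ) : ℂ) * Complex.exp (-(z * x)))) (Ioi 0) :=
    (integrableOn_rpow_mul_cexp_neg_mul (by linarith) (by rwa [hzre])).const_mul _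
  have him (x : ℝ) : (-z * (((x ^ (-a) : ℝ) : ℂ) * Complex.exp (-(z * x)))).im
      = x ^ (-a) * (-z * Complex.exp (-(z * x))).im := by
    rw [mul_left_comm, Complex.im_ofReal_mul]
  have hparts := integral_Ioi_mul_deriv_eq_deriv_mul (a := 0) (a' := 0) (b' := 0)
    (u := fun x : ℝ => sin (t * x) * exp (-(ε * x)))
    (u' := fun x : ℝ => (-z * Complex.exp (-(z * x))).im)
    (v := fun x : ℝ => -x ^ (-a)) (v' := fun x : ℝ => a * x ^ (-a - 1)) ?_ ?_ ?_ ?_ ?_ ?_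
  · have h1 := integral_im hint
    have h2 : (∫ x in Ioi (0 : ℝ), -z * (((x ^ (-a) : ℝ) : ℂ) * Complex.exp (-(z * x))))
        = -((Real.Gamma (1 - a) : ℝ) * z ^ (a : ℂ)) := by
      have h := integral_rpow_mul_cexp_neg_mul (s := 1 - a) (by linarith)
        (show 0 < z.re by rwa [hzre])
      rw [show (1 - a - 1 : ℝ) = -a by ring] at h
      rw [integral_const_mul, h, show (-((1 - a : ℝ) : ℂ)) = (a : ℂ) - 1 by push_cast; ring,
        Complex.cpow_sub _ _ hz0, Complex.cpow_one]
      field_simp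
    rw [h2] at h1
    simp only [RCLike.im_to_complex, him, Complex.neg_im, Complex.im_ofReal_mul] at h1
    rw [← h1, ← integral_const_mul]
    simp only [sub_self, zero_sub, mul_neg, integral_neg, neg_neg] at hparts
    simp only [← mul_assoc, mul_comm] at hparts ⊢
    exact hparts
  · intro x _
    have h : HasDerivAt (fun y : ℝ => Complex.exp (-(z * y))) (-z * Complex.exp (-(z * x))) x := by
      have h' : HasDerivAt (fun w : ℂ => -(z * w)) (-z) (x : ℂ) :=
        ((hasDerivAt_id (x : ℂ)).const_mul z).neg.congr_deriv (by simp)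
      exact (h'.cexp.comp_ofReal).congr_deriv (by ring)
    have h3 := Complex.imCLM.hasFDerivAt.comp_hasDerivAt x h
    refine h3.congr_of_eventuallyEq (.of_forall fun y => ?_)
    exact (im_cexp_neg_mul ε t y).symm
  · intro x (hx : 0 < x)
    exact (hasDerivAt_rpow_const (p := -a) (Or.inl hx.ne')).neg.congr_deriv (by ring)
  · have h : IntegrableOn (fun x : ℝ => a * (x ^ (-a - 1) * (sin (t * x) * exp (-(ε * x)))))
        (Ioi 0) := by
      have hm : Measurable (fun x : ℝ => x ^ (-a - 1) * (sin (t * x) * exp (-(ε * x)))) := by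
        fun_prop
      refine Integrable.const_mul (Integrable.mono (integrableOn_rpow_mul_sin (t := t) ha0 ha1)
        hm.aestronglyMeasurable ?_) a
      filter_upwards [ae_restrict_mem measurableSet_Ioi] with x hx
      exact norm_rpow_mul_sin_mul_exp_le hε.le hx
    refine h.congr_fun (fun x _ => ?_) measurableSet_Ioi
    simp only [Pi.mul_apply]
    ring
  · refine IntegrableOn.congr_fun (Integrable.neg hint.im) (fun x _ => ?_) measurableSet_Ioi
    simp only [Pi.mul_apply, Pi.neg_apply, RCLike.im_to_complex, him]
    ring
  · have h0 : Tendsto (fun x : ℝ => |t| * x ^ (1 - a)) (𝓝[>] 0) (𝓝 0) := by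
      have := (continuousAt_rpow_const 0 (1 - a) (Or.inr (by linarith))).tendsto.const_mul |t|
      rw [zero_rpow (by linarith), mul_zero] at this
      exact this.mono_left nhdsWithin_le_nhds
    refine squeeze_zero_norm' ?_ h0
    filter_upwards [self_mem_nhdsWithin] with x (hx : 0 < x)
    simp only [Pi.mul_apply, norm_mul, norm_neg, Real.norm_eq_abs, abs_exp]
    rw [abs_of_pos (rpow_pos_of_pos hx _)]
    calc |sin (t * x)| * exp (-(ε * x)) * x ^ (-a) ≤ (|t| * x) * 1 * x ^ (-a) := by
          gcongr
          · exact abs_sin_le_abs.trans (by rw [abs_mul, abs_of_pos hx])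
          · rw [exp_le_one_iff]; nlinarith
      _ = |t| * x ^ (1 - a) := by
          rw [sub_eq_add_neg, rpow_add hx, rpow_one]
          ring
  · refine squeeze_zero_norm' ?_ (tendsto_rpow_neg_atTop ha0)
    filter_upwards [eventually_gt_atTop 0] with x hx
    simp only [Pi.mul_apply, norm_mul, norm_neg, Real.norm_eq_abs, abs_exp]
    rw [abs_of_pos (rpow_pos_of_pos hx _)]
    refine mul_le_of_le_one_left (by positivity) (mul_le_one₀ (abs_sin_le_one _) (exp_pos _).le ?_)
    rw [exp_le_one_iff]; nlinarith

theorem im_neg_mul_I_cpow {a t : ℝ} (ht : 0 < t) :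
    ((-(t * Complex.I) : ℂ) ^ (a : ℂ)).im = -(t ^ a * sin (π * a / 2)) := by
  have h : (-(t * Complex.I) : ℂ) = t * (-Complex.I) := by ring
  rw [h, Complex.cpow_def_of_ne_zero (by simp [ht.ne']), Complex.log_ofReal_mul ht (by simp),
    Complex.log_neg_I, Complex.exp_im, rpow_def_of_pos ht]
  simp
  ring_nf

theorem integral_rpow_mul_sin {a t : ℝ} (ha0 : 0 < a) (ha1 : a < 1) (ht : 0 < t) :
    a * ∫ x in Ioi (0 : ℝ), x ^ (-a - 1) * sin (t * x)
      = Real.Gamma (1 - a) * sin (π * a / 2) * t ^ a := by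
  have hL : Tendsto (fun ε : ℝ => a * ∫ x in Ioi (0 : ℝ),
      x ^ (-a - 1) * (sin (t * x) * exp (-(ε * x)))) (𝓝[>] 0)
      (𝓝 (a * ∫ x in Ioi (0 : ℝ), x ^ (-a - 1) * sin (t * x))) := by
    refine Tendsto.const_mul a (tendsto_integral_filter_of_dominated_convergence
      (fun x => ‖x ^ (-a - 1) * sin (t * x)‖) ?_ ?_ (integrableOn_rpow_mul_sin ha0 ha1).norm ?_)
    · exact .of_forall fun ε => Measurable.aestronglyMeasurable (by fun_prop)
    · filter_upwards [self_mem_nhdsWithin] with ε (hε : 0 < ε)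
      filter_upwards [ae_restrict_mem measurableSet_Ioi] with x hx
      exact norm_rpow_mul_sin_mul_exp_le hε.le hx
    · refine .of_forall fun x => Tendsto.mono_left ?_ nhdsWithin_le_nhds
      exact Continuous.tendsto' (by fun_prop) _ _ (by simp)
  have hR : Tendsto (fun ε : ℝ => -(Real.Gamma (1 - a) * ((ε - t * Complex.I : ℂ) ^ (a : ℂ)).im))
      (𝓝[>] 0) (𝓝 (Real.Gamma (1 - a) * sin (π * a / 2) * t ^ a)) := by
    have hb : Tendsto (fun ε : ℝ => (ε - t * Complex.I : ℂ)) (𝓝[>] 0) (𝓝 (-(t * Complex.I))) :=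
      (Continuous.tendsto' (by fun_prop) _ _ (by simp)).mono_left nhdsWithin_le_nhds
    have hc : ContinuousAt (fun w : ℂ => w ^ (a : ℂ)) (-(t * Complex.I)) :=
      continuousAt_id.cpow continuousAt_const (Or.inr (by simp [ht.ne']))
    have h := ((Complex.continuous_im.tendsto _).comp (hc.tendsto.comp hb)).const_mul
      (Real.Gamma (1 - a)) |>.neg
    rw [im_neg_mul_I_cpow ht] at h
    rw [mul_neg, neg_neg, ← mul_assoc, mul_right_comm] at h
    exact h
  refine tendsto_nhds_unique hL (hR.congr' ?_)
  filter_upwards [self_mem_nhdsWithin] with ε hε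
  exact (integral_rpow_mul_sin_mul_exp ha0 ha1 hε).symm

theorem sin_div_rpow_neg_inv_rpow {p x : ℝ} (hp : p ≠ 0) (hx : 0 < x) (t : ℝ) :
    sin (t / (x ^ (-(1 / p))) ^ p) = sin (t * x) := by
  rw [← rpow_mul hx.le, show -(1 / p) * p = -1 by field_simp, rpow_neg_one, div_inv_eq_mul]

theorem integrableOn_sin_div_rpow {p : ℝ} (hp : 1 < p) (t : ℝ) :
    IntegrableOn (fun x : ℝ => sin (t / x ^ p)) (Ioi 0) := by
  have hp0 : 0 < p := one_pos.trans hp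
  have ha : (-(1 / p)) ≠ 0 := neg_ne_zero.2 (one_div_pos.2 hp0).ne'
  rw [← integrableOn_Ioi_comp_rpow_iff' _ ha]
  refine (integrableOn_rpow_mul_sin (t := t) (one_div_pos.2 hp0)
    ((div_lt_one hp0).2 hp)).congr_fun (fun x hx => ?_) measurableSet_Ioi
  simp only [sin_div_rpow_neg_inv_rpow hp0.ne' hx, smul_eq_mul]

theorem integral_sin_div_rpow {p t : ℝ} (hp : 1 < p) (ht : 0 < t) :
    ∫ x in Ioi (0 : ℝ), sin (t / x ^ p)
      = Real.Gamma (1 - 1 / p) * sin (π / (2 * p)) * t ^ (1 / p) := by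
  have hp0 : 0 < p := one_pos.trans hp
  have ha : 0 < 1 / p := one_div_pos.2 hp0
  have h := integral_rpow_mul_sin ha ((div_lt_one hp0).2 hp) ht
  rw [show π * (1 / p) / 2 = π / (2 * p) by field_simp] at h
  rw [← h, ← integral_comp_rpow_Ioi _ (neg_ne_zero.2 ha.ne'), ← integral_const_mul]
  refine setIntegral_congr_fun measurableSet_Ioi (fun x hx => ?_)
  simp only [sin_div_rpow_neg_inv_rpow hp0.ne' hx, smul_eq_mul, abs_neg, abs_of_pos ha, mul_assoc]

theorem intervalIntegrable_sin_div_rpow {p : ℝ} (hp : 1 < p) (t : ℝ) {b c : ℝ} (hb : 0 ≤ b)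
    (hbc : b ≤ c) : IntervalIntegrable (fun x : ℝ => sin (t / x ^ p)) volume b c :=
  (intervalIntegrable_iff_integrableOn_Ioc_of_le hbc).2
    ((integrableOn_sin_div_rpow hp t).mono_set fun _ hx => hb.trans_lt hx.1)

theorem abs_sum_sin_sub_integral_le_two_mul {p t : ℝ} (N : ℕ) :
    |(∑ n ∈ Finset.range N, sin (t / ((n : ℝ) + 1) ^ p)) - ∫ x in (0 : ℝ)..N, sin (t / x ^ p)|
      ≤ 2 * N := by
  have h1 : |∑ n ∈ Finset.range N, sin (t / ((n : ℝ) + 1) ^ p)| ≤ N := by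
    refine (Finset.abs_sum_le_sum_abs _ _).trans ?_
    simpa using Finset.sum_le_card_nsmul (Finset.range N)
      (fun n => |sin (t / ((n : ℝ) + 1) ^ p)|) 1 fun n _ => abs_sin_le_one _
  have h2 : |∫ x in (0 : ℝ)..N, sin (t / x ^ p)| ≤ N := by
    simpa using intervalIntegral.norm_integral_le_of_norm_le_const (a := 0) (b := (N : ℝ))
      (f := fun x : ℝ => sin (t / x ^ p)) (C := 1) fun x _ => abs_sin_le_one _
  linarith [abs_sub (∑ n ∈ Finset.range N, sin (t / ((n : ℝ) + 1) ^ p))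
    (∫ x in (0 : ℝ)..N, sin (t / x ^ p))]

theorem abs_sin_sub_integral_le {p t : ℝ} (hp : 1 < p) (ht : 0 < t) {n : ℝ} (hn : 0 < n) :
    |sin (t / (n + 1) ^ p) - ∫ x in n..(n + 1), sin (t / x ^ p)|
      ≤ t / n ^ p - t / (n + 1) ^ p := by
  have h1 : sin (t / (n + 1) ^ p) - ∫ x in n..(n + 1), sin (t / x ^ p)
      = ∫ x in n..(n + 1), (sin (t / (n + 1) ^ p) - sin (t / x ^ p)) := by
    rw [intervalIntegral.integral_sub intervalIntegrable_const
      (intervalIntegrable_sin_div_rpow hp t hn.le (by linarith))]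
    simp
  have h2 := intervalIntegral.norm_integral_le_of_norm_le_const (a := n) (b := n + 1)
    (f := fun x : ℝ => sin (t / (n + 1) ^ p) - sin (t / x ^ p))
    (C := t / n ^ p - t / (n + 1) ^ p) fun x hx => ?_
  · rw [h1]
    simpa using h2
  · rw [uIoc_of_le (by linarith)] at hx
    have hx0 : 0 < x := hn.trans hx.1
    have hl : t / (n + 1) ^ p ≤ t / x ^ p := by
      gcongr
      exact hx.2
    have hr : t / x ^ p ≤ t / n ^ p := by
      gcongr
      exact hx.1.le
    refine (abs_sin_sub_sin_le _ _).trans ?_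
    rw [abs_sub_comm, abs_of_nonneg (by linarith)]
    linarith

theorem abs_sum_sin_sub_integral_le {p t : ℝ} (hp : 1 < p) (ht : 0 < t) {N : ℕ} (hN : 0 < N)
    {M : ℕ} (hM : N ≤ M) :
    |(∑ n ∈ Finset.range M, sin (t / ((n : ℝ) + 1) ^ p)) - ∫ x in (0 : ℝ)..M, sin (t / x ^ p)|
      ≤ 2 * N + (t / (N : ℝ) ^ p - t / (M : ℝ) ^ p) := by
  induction M, hM using Nat.le_induction with
  | base => simpa using abs_sum_sin_sub_integral_le_two_mul N
  | succ M hM ih =>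
    have hM0 : (0 : ℝ) < M := by exact_mod_cast hN.trans_le hM
    rw [Finset.sum_range_succ, Nat.cast_add_one, ← intervalIntegral.integral_add_adjacent_intervals
      (intervalIntegrable_sin_div_rpow hp t le_rfl hM0.le)
      (intervalIntegrable_sin_div_rpow hp t hM0.le (by linarith)), add_sub_add_comm]
    refine (abs_add_le _ _).trans ?_
    linarith [abs_sin_sub_integral_le hp ht hM0]

theorem summable_one_div_nat_add_one_rpow {p : ℝ} (hp : 1 < p) :
    Summable (fun n : ℕ => 1 / ((n : ℝ) + 1) ^ p) := by
  simpa using (summable_nat_add_iff 1).2 (Real.summable_one_div_nat_rpow.2 hp)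

theorem abs_sin_div_rpow_le {p t : ℝ} (ht : 0 ≤ t) (n : ℕ) :
    |sin (t / ((n : ℝ) + 1) ^ p)| ≤ t * (1 / ((n : ℝ) + 1) ^ p) := by
  refine abs_sin_le_abs.trans_eq ?_
  rw [abs_of_nonneg (by positivity), mul_one_div]

theorem summable_sin_div_rpow {p t : ℝ} (hp : 1 < p) (ht : 0 ≤ t) :
    Summable (fun n : ℕ => sin (t / ((n : ℝ) + 1) ^ p)) :=
  ((summable_one_div_nat_add_one_rpow hp).mul_left t).of_norm_bounded (abs_sin_div_rpow_le ht)

theorem abs_tsum_sin_le {p t : ℝ} (hp : 1 < p) (ht : 0 ≤ t) :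
    |∑' n : ℕ, sin (t / ((n : ℝ) + 1) ^ p)| ≤ t * ∑' n : ℕ, 1 / ((n : ℝ) + 1) ^ p :=
  tsum_of_norm_bounded (f := fun n : ℕ => sin (t / ((n : ℝ) + 1) ^ p)) ((summable_one_div_nat_add_one_rpow hp).hasSum.mul_left t)
    (abs_sin_div_rpow_le ht)

theorem abs_tsum_sin_sub_integral_le {p t : ℝ} (hp : 1 < p) (ht : 0 < t) {N : ℕ} (hN : 0 < N) :
    |(∑' n : ℕ, sin (t / ((n : ℝ) + 1) ^ p)) - ∫ x in Ioi (0 : ℝ), sin (t / x ^ p)|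
      ≤ 2 * N + t / (N : ℝ) ^ p := by
  have h := ((summable_sin_div_rpow hp ht.le).hasSum.tendsto_sum_nat.sub
    (intervalIntegral_tendsto_integral_Ioi 0 (integrableOn_sin_div_rpow hp t)
      tendsto_natCast_atTop_atTop)).abs
  refine le_of_tendsto h ?_
  filter_upwards [eventually_ge_atTop N] with M hM
  have hpos : 0 ≤ t / (M : ℝ) ^ p := by positivity
  linarith [abs_sum_sin_sub_integral_le hp ht hN hM]

theorem abs_tsum_sin_sub_le_of_one_le {p t : ℝ} (hp : 1 < p) (ht : 1 ≤ t) :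
    |(∑' n : ℕ, sin (t / ((n : ℝ) + 1) ^ p))
        - Real.Gamma (1 - 1 / p) * sin (π / (2 * p)) * t ^ (1 / p)| ≤ 5 * t ^ (1 / (p + 1)) := by
  have ht0 : 0 < t := one_pos.trans_le ht
  set s := t ^ (1 / (p + 1)) with hs
  have hs1 : 1 ≤ s := one_le_rpow ht (by positivity)
  have hs0 : 0 < s := one_pos.trans_le hs1
  have hts : t = s ^ p * s := by
    rw [← rpow_add_one hs0.ne', hs, ← rpow_mul ht0.le, one_div_mul_cancel (by linarith), rpow_one]
  have h := abs_tsum_sin_sub_integral_le hp ht0 (Nat.ceil_pos.2 hs0)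
  rw [integral_sin_div_rpow hp ht0] at h
  have h1 : t / (⌈s⌉₊ : ℝ) ^ p ≤ s := by
    rw [div_le_iff₀ (by positivity), hts, mul_comm]
    gcongr
    exact Nat.le_ceil s
  linarith [Nat.ceil_lt_add_one hs0.le]

theorem abs_tsum_sin_sub_le_of_le_one {p t : ℝ} (hp : 1 < p) (ht0 : 0 < t) (ht : t ≤ 1) (α : ℝ) :
    |(∑' n : ℕ, sin (t / ((n : ℝ) + 1) ^ p)) - α * t ^ (1 / p)|
      ≤ ((∑' n : ℕ, 1 / ((n : ℝ) + 1) ^ p) + |α|) * t ^ (1 / (p + 1)) := by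
  have hz : 0 ≤ ∑' n : ℕ, 1 / ((n : ℝ) + 1) ^ p := tsum_nonneg fun n => by positivity
  have h1 : t ≤ t ^ (1 / (p + 1)) := by
    conv_lhs => rw [← rpow_one t]
    exact rpow_le_rpow_of_exponent_ge ht0 ht ((div_le_one (by linarith)).2 (by linarith))
  have h2 : t ^ (1 / p) ≤ t ^ (1 / (p + 1)) :=
    rpow_le_rpow_of_exponent_ge ht0 ht (one_div_le_one_div_of_le (by linarith) (by linarith))
  refine (abs_sub _ _).trans ?_
  rw [abs_mul, abs_of_pos (rpow_pos_of_pos ht0 (1 / p)), add_mul]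
  refine add_le_add ((abs_tsum_sin_le hp ht0.le).trans ?_) (by gcongr)
  rw [mul_comm]
  gcongr

theorem exists_abs_tsum_sin_sub_le {p : ℝ} (hp : 1 < p) :
    ∃ C > 0, ∀ t : ℝ, 0 < t →
      |(∑' n : ℕ, sin (t / ((n : ℝ) + 1) ^ p))
          - Real.Gamma (1 - 1 / p) * sin (π / (2 * p)) * t ^ (1 / p)|
        ≤ C * t ^ (1 / (p + 1)) := by
  set α := Real.Gamma (1 - 1 / p) * sin (π / (2 * p))
  have hz : 0 ≤ ∑' n : ℕ, 1 / ((n : ℝ) + 1) ^ p := tsum_nonneg fun n => by positivity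
  refine ⟨5 + ((∑' n : ℕ, 1 / ((n : ℝ) + 1) ^ p) + |α|), by positivity, fun t ht0 => ?_⟩
  rcases le_total t 1 with ht | ht
  · refine (abs_tsum_sin_sub_le_of_le_one hp ht0 ht α).trans ?_
    exact mul_le_mul_of_nonneg_right (by linarith) (by positivity)
  · refine (abs_tsum_sin_sub_le_of_one_le hp ht).trans ?_
    exact mul_le_mul_of_nonneg_right (by linarith [abs_nonneg α]) (by positivity)

/-- Main theorem: for `p > 1` there is `C > 0` with
`|S_p(t) − α_p·sign(t)·|t|^{1/p}| ≤ C·|t|^{1/(p+1)}` for all real `t`,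
where `α_p = Γ(1−1/p)·sin(π/(2p))`. -/
theorem stmt_10 (p : ℝ) (hp : 1 < p) :
    ∃ C > 0, ∀ t : ℝ,
      |(∑' n : ℕ, Real.sin (t / ((n : ℝ) + 1) ^ p))
        - Real.Gamma (1 - 1 / p) * Real.sin (π / (2 * p))
            * Real.sign t * |t| ^ (1 / p)|
      ≤ C * |t| ^ (1 / (p + 1)) := by
  obtain ⟨C, hC, h⟩ := exists_abs_tsum_sin_sub_le hp
  refine ⟨C, hC, fun t => ?_⟩
  rcases lt_trichotomy t 0 with ht | rfl | ht
  · have hodd : ∑' n : ℕ, sin (t / ((n : ℝ) + 1) ^ p)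
        = -∑' n : ℕ, sin (-t / ((n : ℝ) + 1) ^ p) := by
      rw [← tsum_neg]
      simp only [neg_div, sin_neg, neg_neg]
    rw [hodd, sign_of_neg ht, abs_of_neg ht, mul_neg_one, neg_mul, ← neg_sub', abs_neg]
    exact h (-t) (neg_pos.2 ht)
  · simpa using mul_nonneg hC.le (rpow_nonneg le_rfl _)
  · rw [sign_of_pos ht, abs_of_pos ht, mul_one]
    exact h t ht
end

section
/- For p > 1 and 1 < Re s < p, ∫_0^∞ r^{s−1} ∑_{n=1}^∞ sin((nr)^{−p}) dr = ζ(s) · (1/p) · Γ(−s/p) · sin(−(π/2)(s/p)). -/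
open Real Complex MeasureTheory

open Filter Topology Set Asymptotics

theorem norm_cexp_neg_mul_ofReal (r : ℂ) (t : ℝ) :
    ‖Complex.exp (-(r * t))‖ = Real.exp (-r.re * t) := by
  rw [Complex.norm_exp]; simp

theorem mellinConvergent_cexp_neg_mul {a r : ℂ} (ha : 0 < a.re) (hr : 0 < r.re) :
    MellinConvergent (fun t : ℝ => Complex.exp (-(r * t))) a := by
  have hc : Continuous fun t : ℝ => Complex.exp (-(r * t)) := by fun_prop
  refine mellinConvergent_of_isBigO_rpow_exp (a := r.re) (b := 0) hr
    (hc.locallyIntegrable.locallyIntegrableOn _) ?_ ?_ ha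
  · exact IsBigO.of_bound 1 (Eventually.of_forall fun t => by
      rw [norm_cexp_neg_mul_ofReal, Real.norm_of_nonneg (Real.exp_pos _).le, one_mul])
  · simp only [neg_zero, Real.rpow_zero]
    exact (hc.continuousAt (x := 0)).norm.isBoundedUnder_le.isBigO_one ℝ |>.mono
      nhdsWithin_le_nhds

theorem differentiableAt_mellin_cexp_neg_mul {a r : ℂ} (ha : 0 < a.re) (hr : 0 < r.re) :
    DifferentiableAt ℂ (fun z : ℂ => mellin (fun t : ℝ => Complex.exp (-(z * t))) a) r := by
  have hr2 : 0 < ((r.re / 2 : ℝ) : ℂ).re := by rw [ofReal_re]; linarith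
  have ha1 : 0 < (a + 1).re := by simp; linarith
  have hs : {z : ℂ | r.re / 2 < z.re} ∈ 𝓝 r :=
    (isOpen_re_gt (r.re / 2)).mem_nhds (half_lt_self hr)
  have hpos : ∀ᶠ z : ℂ in 𝓝 r, 0 < z.re := (isOpen_re_gt 0).mem_nhds hr
  refine (hasDerivAt_integral_of_dominated_loc_of_deriv_le hs
    (bound := fun t : ℝ => ‖(t : ℂ) ^ (a + 1 - 1) •
      Complex.exp (-(((r.re / 2 : ℝ) : ℂ) * t))‖)
    (F' := fun z t => (t : ℂ) ^ (a - 1) • (Complex.exp (-(z * t)) * -(t : ℂ)))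
    (hpos.mono fun z hz => (mellinConvergent_cexp_neg_mul ha hz).aestronglyMeasurable)
    (mellinConvergent_cexp_neg_mul ha hr) ?_ ?_
    (mellinConvergent_cexp_neg_mul ha1 hr2).norm ?_).2.differentiableAt
  · have h := ((mellinConvergent_cexp_neg_mul ha hr).aestronglyMeasurable).mul
      (Complex.continuous_ofReal.neg.aestronglyMeasurable (μ := volume.restrict (Ioi 0)))
    refine h.congr (Eventually.of_forall fun t => ?_)
    simp [mul_assoc]
  · filter_upwards [ae_restrict_mem measurableSet_Ioi] with t ht z hz
    have ht : 0 < t := ht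
    have hz : r.re / 2 < z.re := hz
    rw [norm_smul, norm_smul, norm_mul, norm_cexp_neg_mul_ofReal, norm_cexp_neg_mul_ofReal,
      norm_neg, norm_real, Real.norm_of_nonneg ht.le, norm_cpow_eq_rpow_re_of_pos ht,
      norm_cpow_eq_rpow_re_of_pos ht, ofReal_re, add_sub_cancel_right, sub_re, one_re,
      Real.rpow_sub_one ht.ne']
    have : Real.exp (-z.re * t) ≤ Real.exp (-(r.re / 2) * t) := by gcongr
    calc t ^ a.re / t * (Real.exp (-z.re * t) * t) = t ^ a.re * Real.exp (-z.re * t) := by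
          field_simp
      _ ≤ _ := by gcongr
  · refine Eventually.of_forall fun t z _ => ?_
    have h1 : HasDerivAt (fun z : ℂ => -(z * t)) (-(t : ℂ)) z := by
      simpa using ((hasDerivAt_id z).mul_const (t : ℂ)).fun_neg
    exact h1.cexp.fun_const_smul _

theorem mellin_cexp_neg_mul {a r : ℂ} (ha : 0 < a.re) (hr : 0 < r.re) :
    mellin (fun t : ℝ => Complex.exp (-(r * t))) a = r ^ (-a) * Complex.Gamma a := by
  have hopen := isOpen_re_gt 0
  refine AnalyticOnNhd.eqOn_of_preconnected_of_frequently_eq (𝕜 := ℂ)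
    (f := fun z : ℂ => mellin (fun t : ℝ => Complex.exp (-(z * t))) a)
    (g := fun z : ℂ => z ^ (-a) * Complex.Gamma a) (z₀ := 1) (U := {z : ℂ | 0 < z.re})
    (DifferentiableOn.analyticOnNhd (fun z hz =>
      (differentiableAt_mellin_cexp_neg_mul ha hz).differentiableWithinAt) hopen)
    (DifferentiableOn.analyticOnNhd (fun z hz => ?_) hopen)
    (convex_halfSpace_re_gt 0).isPreconnected (by simp) ?_ hr
  · exact ((differentiableAt_id.cpow_const (Or.inl hz)).mul_const _).differentiableWithinAt
  · have hreal : ∀ᶠ x : ℝ in 𝓝[≠] 1,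
        mellin (fun t : ℝ => Complex.exp (-((x : ℂ) * t))) a
          = (x : ℂ) ^ (-a) * Complex.Gamma a := by
      filter_upwards [nhdsWithin_le_nhds (lt_mem_nhds (zero_lt_one' ℝ))] with x hx
      have h := Complex.integral_cpow_mul_exp_neg_mul_Ioi ha hx
      simp only [mellin, smul_eq_mul, h]
      rw [one_div, inv_cpow _ _ (by rw [arg_ofReal_of_nonneg hx.le]; exact pi_pos.ne), cpow_neg]
    have ht : Tendsto (fun x : ℝ => (x : ℂ)) (𝓝[≠] 1) (𝓝[≠] 1) := by
      refine tendsto_nhdsWithin_iff.2 ⟨?_, ?_⟩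
      · exact (Complex.continuous_ofReal.tendsto' 1 1 (by simp)).mono_left nhdsWithin_le_nhds
      · filter_upwards [self_mem_nhdsWithin] with x hx
        simpa using hx
    exact ht.frequently hreal.frequently

theorem isBigO_sin_nhdsGT_zero :
    (fun t : ℝ => (Real.sin t : ℂ)) =O[𝓝[>] 0] fun t : ℝ => t ^ (-(-1) : ℝ) :=
  IsBigO.of_bound 1 (Eventually.of_forall fun t => by
    simpa [norm_real, -ofReal_sin] using Real.abs_sin_le_abs (x := t))

theorem mellinConvergent_sin {w : ℂ} (h1 : -1 < w.re) (h0 : w.re < 0) :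
    MellinConvergent (fun t : ℝ => (Real.sin t : ℂ)) w := by
  have hc : Continuous fun t : ℝ => (Real.sin t : ℂ) := by fun_prop
  refine mellinConvergent_of_isBigO_rpow (a := 0) (b := -1)
    (hc.locallyIntegrable.locallyIntegrableOn _) ?_ h0 isBigO_sin_nhdsGT_zero h1
  exact IsBigO.of_bound 1 (Eventually.of_forall fun t => by
    simpa [norm_real, -ofReal_sin] using Real.abs_sin_le_one t)

/-- The Mellin transform of the damped sine `exp (-ε t) sin t`. -/
theorem mellin_exp_neg_mul_sin {ε : ℝ} (hε : 0 < ε) {w : ℂ} (hw : -1 < w.re) :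
    w * mellin (fun t : ℝ => ((Real.exp (-ε * t) * Real.sin t : ℝ) : ℂ)) w =
      Complex.Gamma (w + 1) * (((ε - I) ^ (-w) - (ε + I) ^ (-w)) / (2 * I)) := by
  have hne1 : (ε - I : ℂ) ≠ 0 := fun h => by simpa using congrArg Complex.im h
  have hne2 : (ε + I : ℂ) ≠ 0 := fun h => by simpa using congrArg Complex.im h
  have hc : Continuous fun t : ℝ => ((Real.exp (-ε * t) * Real.sin t : ℝ) : ℂ) := by fun_prop
  have hopen := isOpen_re_gt (-1)
  refine AnalyticOnNhd.eqOn_of_preconnected_of_eventuallyEq (𝕜 := ℂ)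
    (f := fun w : ℂ => w * mellin (fun t : ℝ => ((Real.exp (-ε * t) * Real.sin t : ℝ) : ℂ)) w)
    (g := fun w : ℂ => Complex.Gamma (w + 1) * (((ε - I) ^ (-w) - (ε + I) ^ (-w)) / (2 * I)))
    (z₀ := 1) (U := {z : ℂ | -1 < z.re})
    (DifferentiableOn.analyticOnNhd (fun z hz => ?_) hopen)
    (DifferentiableOn.analyticOnNhd (fun z hz => ?_) hopen)
    (convex_halfSpace_re_gt (-1)).isPreconnected (by simp) ?_ hw
  · refine (differentiableAt_id.mul (mellin_differentiableAt_of_isBigO_rpow_exp (b := -1) hε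
      (hc.locallyIntegrable.locallyIntegrableOn _) ?_ ?_ hz)).differentiableWithinAt
    · refine IsBigO.of_bound 1 (Eventually.of_forall fun t => ?_)
      rw [norm_real, norm_mul, one_mul]
      exact mul_le_of_le_one_right (norm_nonneg _) (Real.abs_sin_le_one t)
    · refine IsBigO.trans (IsBigO.of_bound 1 ?_) isBigO_sin_nhdsGT_zero
      filter_upwards [self_mem_nhdsWithin] with t ht
      have ht : 0 < t := ht
      rw [norm_real, norm_real, norm_mul, one_mul]
      refine mul_le_of_le_one_left (norm_nonneg _) ?_
      rw [Real.norm_of_nonneg (Real.exp_pos _).le, Real.exp_le_one_iff]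
      nlinarith
  · have hz : -1 < z.re := hz
    have hG : DifferentiableAt ℂ Complex.Gamma (z + 1) := by
      refine Complex.differentiableAt_Gamma _ fun m h => ?_
      have := congrArg Complex.re h
      simp at this
      have : (0 : ℝ) ≤ m := m.cast_nonneg
      linarith
    have hG' : DifferentiableAt ℂ (fun z => Complex.Gamma (z + 1)) z :=
      hG.comp z (by fun_prop)
    exact (hG'.mul (((differentiableAt_id.neg.const_cpow (Or.inl hne1)).sub
      (differentiableAt_id.neg.const_cpow (Or.inl hne2))).div_const _)).differentiableWithinAt
  · filter_upwards [(isOpen_re_gt 0).mem_nhds (show (1 : ℂ) ∈ {z : ℂ | 0 < z.re} by simp)]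
      with z hz
    have hz : 0 < z.re := hz
    have hz0 : z ≠ 0 := fun h => by simp [h] at hz
    have hr1 : 0 < (ε - I : ℂ).re := by simpa
    have hr2 : 0 < (ε + I : ℂ).re := by simpa
    have hsub := hasMellin_sub (mellinConvergent_cexp_neg_mul hz hr1)
      (mellinConvergent_cexp_neg_mul hz hr2)
    have hfun : (fun t : ℝ => ((Real.exp (-ε * t) * Real.sin t : ℝ) : ℂ)) = fun t : ℝ =>
        (Complex.exp (-((ε - I) * t)) - Complex.exp (-((ε + I) * t))) / (2 * I) := by
      ext t
      rw [show -((ε - I : ℂ) * t) = -ε * t + t * I by ring,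
        show -((ε + I : ℂ) * t) = -ε * t + -t * I by ring, Complex.exp_add, Complex.exp_add]
      push_cast
      rw [Complex.sin, eq_div_iff (by simp)]
      ring_nf
      simp only [I_sq]
      ring_nf
    rw [hfun, mellin_div_const, hsub.2, mellin_cexp_neg_mul hz hr1, mellin_cexp_neg_mul hz hr2,
      Complex.Gamma_add_one z hz0]
    ring

theorem mellin_sin {w : ℂ} (h1 : -1 < w.re) (h0 : w.re < 0) :
    mellin (fun t : ℝ => (Real.sin t : ℂ)) w =
      Complex.Gamma w * Complex.sin (Real.pi / 2 * w) := by
  have hw0 : w ≠ 0 := fun h => by simp [h] at h0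
  have hconv := mellinConvergent_sin h1 h0
  have hL : Tendsto
      (fun ε : ℝ => w * mellin (fun t : ℝ => ((Real.exp (-ε * t) * Real.sin t : ℝ) : ℂ)) w)
      (𝓝[>] 0) (𝓝 (w * mellin (fun t : ℝ => (Real.sin t : ℂ)) w)) := by
    refine Tendsto.const_mul _ (tendsto_integral_filter_of_dominated_convergence
      (fun t : ℝ => ‖(t : ℂ) ^ (w - 1) • (Real.sin t : ℂ)‖) ?_ ?_ hconv.norm ?_)
    · refine Eventually.of_forall fun ε => ?_
      have hexp : Continuous fun t : ℝ => (Real.exp (-ε * t) : ℂ) := by fun_prop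
      refine (hconv.aestronglyMeasurable.mul
        (hexp.aestronglyMeasurable (μ := volume.restrict (Ioi 0)))).congr
        (Eventually.of_forall fun t => ?_)
      simp only [smul_eq_mul, Pi.mul_apply, ofReal_mul]
      ring
    · filter_upwards [self_mem_nhdsWithin] with ε hε
      have hε : 0 < ε := hε
      filter_upwards [ae_restrict_mem measurableSet_Ioi] with t ht
      have ht : 0 < t := ht
      rw [norm_smul, norm_smul, ofReal_mul, norm_mul]
      gcongr
      refine mul_le_of_le_one_left (norm_nonneg _) ?_
      rw [norm_real, Real.norm_of_nonneg (Real.exp_pos _).le, Real.exp_le_one_iff]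
      nlinarith
    · refine Eventually.of_forall fun t => Tendsto.const_smul ?_ _
      have hc : Continuous fun ε : ℝ => ((Real.exp (-ε * t) * Real.sin t : ℝ) : ℂ) := by
        fun_prop
      exact (hc.tendsto' 0 _ (by simp)).mono_left nhdsWithin_le_nhds
  have hR : Tendsto (fun ε : ℝ =>
      Complex.Gamma (w + 1) * ((((ε : ℂ) - I) ^ (-w) - (ε + I) ^ (-w)) / (2 * I))) (𝓝[>] 0)
      (𝓝 (Complex.Gamma (w + 1) * (((-I) ^ (-w) - I ^ (-w)) / (2 * I)))) := by
    have hm : Tendsto (fun ε : ℝ => (ε : ℂ) - I) (𝓝[>] 0) (𝓝 (-I)) :=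
      ((Complex.continuous_ofReal.sub continuous_const).tendsto' 0 _ (by simp)).mono_left
        nhdsWithin_le_nhds
    have hp : Tendsto (fun ε : ℝ => (ε : ℂ) + I) (𝓝[>] 0) (𝓝 I) :=
      ((Complex.continuous_ofReal.add continuous_const).tendsto' 0 _ (by simp)).mono_left
        nhdsWithin_le_nhds
    exact (((hm.cpow tendsto_const_nhds (Or.inr (by simp))).sub
      (hp.cpow tendsto_const_nhds (Or.inr (by simp)))).div_const _).const_mul _
  have hEq := tendsto_nhds_unique (hL.congr' (by
    filter_upwards [self_mem_nhdsWithin] with ε hε using mellin_exp_neg_mul_sin hε h1)) hR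
  have hI1 : (-I) ^ (-w) = Complex.exp (Real.pi / 2 * w * I) := by
    rw [cpow_def_of_ne_zero (by simp), log_neg_I]; congr 1; ring
  have hI2 : I ^ (-w) = Complex.exp (-(Real.pi / 2 * w) * I) := by
    rw [cpow_def_of_ne_zero (by simp), log_I]; congr 1; ring
  rw [hI1, hI2, Complex.Gamma_add_one w hw0, mul_assoc] at hEq
  rw [mul_left_cancel₀ hw0 hEq, Complex.sin]
  congr 1
  field_simp
  rw [I_sq]
  ring

/-- The Mellin transform of `∑ f((n + 1) r)` is `ζ(s)` times that of `f`. -/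
theorem integral_cpow_mul_tsum_comp_nat_add_one_mul {f : ℝ → ℂ} {s : ℂ} (hs : 1 < s.re)
    (hf : MellinConvergent f s) :
    ∫ r in Ioi (0 : ℝ), (r : ℂ) ^ (s - 1) * ∑' n : ℕ, f (((n : ℝ) + 1) * r) =
      riemannZeta s * mellin f s := by
  have hpos (n : ℕ) : (0 : ℝ) < (n : ℝ) + 1 := by positivity
  have hnorm (n : ℕ) : ∫ r in Ioi (0 : ℝ), ‖(r : ℂ) ^ (s - 1) • f (((n : ℝ) + 1) * r)‖ =
      1 / ((n : ℝ) + 1) ^ s.re * ∫ r in Ioi (0 : ℝ), ‖(r : ℂ) ^ (s - 1) • f r‖ := by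
    have h := integral_comp_mul_left_Ioi (fun u : ℝ => ‖(u : ℂ) ^ (s - 1) • f u‖) 0 (hpos n)
    rw [mul_zero, smul_eq_mul] at h
    have h2 : ∫ r in Ioi (0 : ℝ), ‖(r : ℂ) ^ (s - 1) • f (((n : ℝ) + 1) * r)‖ =
        ∫ r in Ioi (0 : ℝ), (((n : ℝ) + 1) ^ (s.re - 1))⁻¹ *
          ‖((((n : ℝ) + 1) * r : ℝ) : ℂ) ^ (s - 1) • f (((n : ℝ) + 1) * r)‖ := by
      refine setIntegral_congr_fun measurableSet_Ioi fun r hr => ?_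
      have hr : 0 < r := hr
      simp only [norm_smul]
      rw [norm_cpow_eq_rpow_re_of_pos hr, norm_cpow_eq_rpow_re_of_pos (mul_pos (hpos n) hr),
        sub_re, one_re, Real.mul_rpow (hpos n).le hr.le, ← mul_assoc, ← mul_assoc,
        inv_mul_cancel₀ (Real.rpow_pos_of_pos (hpos n) _).ne', one_mul]
    rw [h2, integral_const_mul, h, ← mul_assoc, Real.rpow_sub_one (hpos n).ne']
    congr 1
    have := (hpos n).ne'
    field_simp
  have hsum : Summable fun n : ℕ => 1 / ((n : ℝ) + 1) ^ s.re := by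
    have := (summable_nat_add_iff 1).2 (Real.summable_one_div_nat_rpow.2 hs)
    simpa using this
  have h := hasSum_integral_of_summable_integral_norm (μ := volume.restrict (Ioi (0 : ℝ)))
    (F := fun (n : ℕ) (r : ℝ) => (r : ℂ) ^ (s - 1) • f (((n : ℝ) + 1) * r))
    (fun n => (MellinConvergent.comp_mul_left (hpos n)).2 hf)
    (by simp_rw [hnorm]; exact hsum.mul_right _)
  simp only [smul_eq_mul, tsum_mul_left] at h
  rw [← h.tsum_eq, zeta_eq_tsum_one_div_nat_add_one_cpow hs, ← tsum_mul_right]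
  refine tsum_congr fun n => ?_
  have := mellin_comp_mul_left f s (hpos n)
  simp only [mellin, smul_eq_mul] at this ⊢
  rw [this, cpow_neg, one_div]
  push_cast
  rfl

/-- Mellin transform of `R_p(r) = ∑_{n=1}^∞ sin((nr)^{−p})`: for `p > 1` and
`1 < Re s < p`,
`∫_0^∞ r^{s−1} R_p(r) dr = ζ(s)·(1/p)·Γ(−s/p)·sin(−(π/2)(s/p))`. -/
theorem stmt_17 (p : ℝ) (hp : 1 < p) (s : ℂ) (hs1 : 1 < s.re) (hsp : s.re < p) :
    ∫ r in Set.Ioi (0 : ℝ),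
        (r : ℂ) ^ (s - 1)
          * ((∑' n : ℕ, Real.sin ((((n : ℝ) + 1) * r) ^ (-p)) : ℝ) : ℂ)
      = riemannZeta s * (1 / (p : ℂ)) * Complex.Gamma (-s / p)
          * Complex.sin (-(Real.pi / 2) * (s / p)) := by
  have hp0 : 0 < p := by linarith
  have hre : (s / ((-p : ℝ) : ℂ)).re = -(s.re / p) := by rw [div_ofReal_re, div_neg]
  have h1 : -1 < (s / ((-p : ℝ) : ℂ)).re := by
    rw [hre, neg_lt_neg_iff, div_lt_one hp0]; exact hsp
  have h0 : (s / ((-p : ℝ) : ℂ)).re < 0 := by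
    rw [hre, neg_lt_zero]; positivity
  have hconv : MellinConvergent (fun t : ℝ => (Real.sin (t ^ (-p)) : ℂ)) s :=
    (MellinConvergent.comp_rpow (f := fun t : ℝ => (Real.sin t : ℂ)) (neg_ne_zero.2 hp0.ne')).2
      (mellinConvergent_sin h1 h0)
  simp_rw [Complex.ofReal_tsum]
  rw [integral_cpow_mul_tsum_comp_nat_add_one_mul hs1 hconv,
    mellin_comp_rpow (fun t : ℝ => (Real.sin t : ℂ)), mellin_sin h1 h0, abs_neg, abs_of_pos hp0,
    real_smul]
  have e1 : s / ((-p : ℝ) : ℂ) = -s / p := by push_cast; rw [div_neg, neg_div]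
  have e2 : Real.pi / 2 * (-s / p) = -(Real.pi / 2) * (s / p : ℂ) := by ring
  rw [e1, e2]
  push_cast
  ring
end
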